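/- arXiv:2012.06692 — 10 statements merged into one kernel-verified Lean document; each statement's English description precedes it below -/
import Mathlib

section
/- Let E be a real inner product space with inner product ⟪·,·⟫ and norm ‖·‖, let W ∈ E with ‖W‖ < 1, set λ := 1 − ⟪W,W⟫, and let F : E → ℝ be the Randers (Zermelo) metric F(V) = (√(⟪W,V⟫² + λ⟪V,V⟫) − ⟪W,V⟫)/λ. Then for every τ > 0, the Randers indicatrix of radius τ is the translation of the Riemannian indicatrix of radius τ by the vector τW; that is, {V ∈ E : F(V) = τ} = {U + τ•W : U ∈ E, ‖U‖ = τ}. Equivalently, for every V ∈ E and τ > 0, F(V) = τ if and only if ‖V − τ•W‖ = τ. -/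
open scoped RealInnerProductSpace

/-- The positive root of the quadratic equation `l * t ^ 2 + 2 * a * t = b`. -/
theorem sqrt_sub_div_eq_iff_of_pos {a b l t : ℝ} (hb : 0 ≤ b) (hl : 0 < l) (ht : 0 < t) :
    (Real.sqrt (a ^ 2 + l * b) - a) / l = t ↔ b = 2 * t * a + t ^ 2 * l := by
  have hnonneg : 0 ≤ a ^ 2 + l * b := by positivity
  rw [div_eq_iff hl.ne', sub_eq_iff_eq_add]
  constructor
  · intro h
    have hsq := Real.sq_sqrt hnonneg
    rw [h] at hsq
    exact mul_left_cancel₀ hl.ne' (by linear_combination -hsq)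
  · rintro rfl
    have h : 0 ≤ 2 * a + t * l :=
      nonneg_of_mul_nonneg_right (by linarith : 0 ≤ t * (2 * a + t * l)) ht
    have htl : 0 < t * l := mul_pos ht hl
    rw [show a ^ 2 + l * (2 * t * a + t ^ 2 * l) = (t * l + a) ^ 2 by ring]
    exact Real.sqrt_sq (by linarith)

/-- The sphere of radius `t` centred at `t • W`, described by inner products. -/
theorem norm_sub_smul_eq_iff_inner {E : Type*} [NormedAddCommGroup E] [InnerProductSpace ℝ E]
    (V W : E) {t : ℝ} (ht : 0 ≤ t) :
    ‖V - t • W‖ = t ↔ ⟪V, V⟫ = 2 * t * ⟪W, V⟫ + t ^ 2 * (1 - ⟪W, W⟫) := by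
  rw [← sq_eq_sq₀ (norm_nonneg _) ht, ← real_inner_self_eq_norm_sq, real_inner_sub_sub_self,
    real_inner_smul_right, real_inner_smul_right, real_inner_smul_left, real_inner_comm W V]
  constructor <;> intro h <;> linear_combination h

theorem randers_indicatrix_translation
    {E : Type*} [NormedAddCommGroup E] [InnerProductSpace ℝ E]
    (W : E) (hW : ‖W‖ < 1)
    (F : E → ℝ)
    (hF : ∀ V : E, F V =
      (Real.sqrt (⟪W, V⟫ ^ 2 + (1 - ⟪W, W⟫) * ⟪V, V⟫) - ⟪W, V⟫) / (1 - ⟪W, W⟫)) :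
    ∀ τ : ℝ, 0 < τ →
      ({V : E | F V = τ} = {X : E | ∃ U : E, ‖U‖ = τ ∧ X = U + τ • W} ∧
        ∀ V : E, F V = τ ↔ ‖V - τ • W‖ = τ) := by
  intro τ hτ
  have hl : 0 < 1 - ⟪W, W⟫ := by
    rw [real_inner_self_eq_norm_sq]
    nlinarith [norm_nonneg W]
  have key (V : E) : F V = τ ↔ ‖V - τ • W‖ = τ := by
    rw [hF, sqrt_sub_div_eq_iff_of_pos real_inner_self_nonneg hl hτ,
      norm_sub_smul_eq_iff_inner V W hτ.le]
  refine ⟨?_, key⟩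
  ext V
  rw [Set.mem_ofPred_eq, key]
  constructor
  · exact fun h => ⟨V - τ • W, h, (sub_add_cancel _ _).symm⟩
  · rintro ⟨U, hU, rfl⟩
    rwa [add_sub_cancel_right]
end

section
/- Let E be a real inner product space with inner product ⟪·,·⟫ and norm ‖·‖, let W ∈ E with ‖W‖ < 1, set λ := 1 − ⟪W,W⟫, and let F : E → ℝ be the Randers metric F(V) = (√(⟪W,V⟫² + λ⟪V,V⟫) − ⟪W,V⟫)/λ. For every point p ∈ E and every τ > 0, the spherical wavefront of radius τ centered at p, namely {q ∈ E : F(q − p) = τ}, equals the sphere of the inner-product norm of radius τ centered at the translated point p + τ•W; that is, {q : F(q − p) = τ} = {q : ‖q − p − τ•W‖ = τ}. -/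
open scoped RealInnerProductSpace

theorem spherical_wavefront_is_translated_sphere
    {E : Type*} [NormedAddCommGroup E] [InnerProductSpace ℝ E]
    (W : E) (hW : ‖W‖ < 1)
    (F : E → ℝ)
    (hF : ∀ V : E, F V =
      (Real.sqrt (⟪W, V⟫ ^ 2 + (1 - ⟪W, W⟫) * ⟪V, V⟫) - ⟪W, V⟫) / (1 - ⟪W, W⟫)) :
    ∀ (p : E) (τ : ℝ), 0 < τ →
      {q : E | F (q - p) = τ} = {q : E | ‖q - p - τ • W‖ = τ} := by
  intro p τ hτ
  ext q
  simp only [Set.mem_ofPred_eq, hF]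
  generalize q - p = V
  have hl : 0 < 1 - ⟪W, W⟫ := by
    rw [real_inner_self_eq_norm_sq]
    nlinarith [norm_nonneg W]
  have hb : 0 ≤ ⟪V, V⟫ := real_inner_self_nonneg
  have hsphere : ‖V - τ • W‖ = τ ↔ ⟪V, V⟫ - 2 * τ * ⟪W, V⟫ + τ ^ 2 * ⟪W, W⟫ = τ ^ 2 := by
    rw [← sq_eq_sq₀ (norm_nonneg _) hτ.le, ← real_inner_self_eq_norm_sq,
      real_inner_sub_sub_self, real_inner_smul_right, real_inner_smul_left,
      real_inner_smul_right, real_inner_comm V W]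
    ring_nf
  rw [hsphere, div_eq_iff hl.ne', sub_eq_iff_eq_add]
  generalize ⟪W, V⟫ = a at *
  generalize ⟪V, V⟫ = b at *
  generalize ⟪W, W⟫ = w at *
  constructor
  · intro h
    have hsq := Real.sq_sqrt (add_nonneg (sq_nonneg a) (mul_nonneg hl.le hb))
    rw [h] at hsq
    apply mul_left_cancel₀ hl.ne'
    linear_combination -hsq
  · intro h
    have hτl : 0 < τ * (1 - w) := mul_pos hτ hl
    have ha : 0 ≤ 2 * a + τ * (1 - w) := by
      refine nonneg_of_mul_nonneg_right (a := τ) ?_ hτ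
      linarith
    rw [show a ^ 2 + (1 - w) * b = (τ * (1 - w) + a) ^ 2 by
      linear_combination (1 - w) * h]
    exact Real.sqrt_sq (by linarith)
end

section
/- Let E be a real inner product space with inner product ⟪·,·⟫ and norm ‖·‖, let W ∈ E with ‖W‖ < 1, set λ := 1 − ⟪W,W⟫, and let F : E → ℝ be the Randers metric F(V) = (√(⟪W,V⟫² + λ⟪V,V⟫) − ⟪W,V⟫)/λ. Then for every continuously differentiable curve γ : [0,1] → E with γ(0) = p and γ(1) = q, the Randers length satisfies ∫₀¹ F(γ′(t)) dt ≥ F(q − p); moreover, the straight segment γ₀(t) = p + t•(q − p) attains this bound, i.e. ∫₀¹ F(γ₀′(t)) dt = F(q − p). Consequently the infimum of ∫₀¹ F(γ′(t)) dt over all C¹ curves from p to q equals F(q − p). -/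
open scoped RealInnerProductSpace

/-- Cauchy–Schwarz for the form `⟪W, u⟫ ⟪W, v⟫ + c ⟪u, v⟫` with `c ≥ 0`. -/
theorem sq_inner_mul_inner_add_le {E : Type*} [NormedAddCommGroup E] [InnerProductSpace ℝ E]
    (W u v : E) {c : ℝ} (hc : 0 ≤ c) :
    (⟪W, u⟫ * ⟪W, v⟫ + c * ⟪u, v⟫) ^ 2 ≤
      (⟪W, u⟫ ^ 2 + c * ⟪u, u⟫) * (⟪W, v⟫ ^ 2 + c * ⟪v, v⟫) := by
  have hsq : 0 ≤ ⟪W, u⟫ ^ 2 * ⟪v, v⟫ + ⟪W, v⟫ ^ 2 * ⟪u, u⟫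
      - 2 * ⟪W, u⟫ * ⟪W, v⟫ * ⟪u, v⟫ := by
    have h := real_inner_self_nonneg (x := ⟪W, u⟫ • v - ⟪W, v⟫ • u)
    simp only [inner_sub_left, inner_sub_right, real_inner_smul_left, real_inner_smul_right,
      real_inner_comm u v] at h
    linarith
  have hcs : ⟪u, v⟫ * ⟪u, v⟫ ≤ ⟪u, u⟫ * ⟪v, v⟫ := real_inner_mul_inner_self_le u v
  nlinarith [mul_nonneg hc hsq, mul_nonneg (mul_nonneg hc hc) (sub_nonneg.2 hcs)]

/-- The Randers metric has a supporting continuous linear functional at every vector. -/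
theorem exists_randers_support {E : Type*} [NormedAddCommGroup E] [InnerProductSpace ℝ E]
    (W v : E) {c : ℝ} (hc : 0 < c) :
    ∃ l : E →L[ℝ] ℝ,
      (∀ V : E, l V ≤ (√(⟪W, V⟫ ^ 2 + c * ⟪V, V⟫) - ⟪W, V⟫) / c) ∧
      l v = (√(⟪W, v⟫ ^ 2 + c * ⟪v, v⟫) - ⟪W, v⟫) / c := by
  set N := √(⟪W, v⟫ ^ 2 + c * ⟪v, v⟫) with hN
  have hl (V : E) : (c⁻¹ • (N⁻¹ • (⟪W, v⟫ • innerSL ℝ W + c • innerSL ℝ v) - innerSL ℝ W)) V =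
      ((⟪W, v⟫ * ⟪W, V⟫ + c * ⟪v, V⟫) / N - ⟪W, V⟫) / c := by
    simp [div_eq_inv_mul, mul_add]
  have hnonneg (V : E) : 0 ≤ ⟪W, V⟫ ^ 2 + c * ⟪V, V⟫ :=
    add_nonneg (sq_nonneg _) (mul_nonneg hc.le real_inner_self_nonneg)
  refine ⟨_, fun V ↦ (hl V).trans_le ?_, (hl v).trans ?_⟩
  · gcongr
    refine div_le_of_le_mul₀ (Real.sqrt_nonneg _) (Real.sqrt_nonneg _) ?_
    rw [mul_comm (√_), hN, ← Real.sqrt_mul (hnonneg v)]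
    exact Real.le_sqrt_of_sq_le (sq_inner_mul_inner_add_le W v V hc.le)
  · rw [← sq, hN, Real.div_sqrt]

/-- A continuous function bounded below by a continuous linear functional that it meets at `q - p`
has integral at least its value at `q - p` along the velocity of any `C¹` curve from `p` to `q`. -/
theorem le_integral_of_support {E : Type*} [NormedAddCommGroup E] [NormedSpace ℝ E]
    {F : E → ℝ} (hF : Continuous F) (l : E →L[ℝ] ℝ) (hle : ∀ V, l V ≤ F V)
    {γ γ' : ℝ → E} (hγ : ∀ t ∈ Set.Icc (0 : ℝ) 1, HasDerivAt γ (γ' t) t)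
    (hγ' : ContinuousOn γ' (Set.Icc (0 : ℝ) 1)) (heq : l (γ 1 - γ 0) = F (γ 1 - γ 0)) :
    F (γ 1 - γ 0) ≤ ∫ t in (0 : ℝ)..1, F (γ' t) := by
  have hl_int : IntervalIntegrable (fun t ↦ l (γ' t)) MeasureTheory.volume 0 1 :=
    (l.continuous.comp_continuousOn hγ').intervalIntegrable_of_Icc zero_le_one
  have hF_int : IntervalIntegrable (fun t ↦ F (γ' t)) MeasureTheory.volume 0 1 :=
    (hF.comp_continuousOn hγ').intervalIntegrable_of_Icc zero_le_one
  have hftc : ∫ t in (0 : ℝ)..1, l (γ' t) = l (γ 1) - l (γ 0) := by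
    refine intervalIntegral.integral_eq_sub_of_hasDerivAt (f := fun t ↦ l (γ t))
      (fun t ht ↦ ?_) hl_int
    rw [Set.uIcc_of_le zero_le_one] at ht
    exact l.hasFDerivAt.comp_hasDerivAt t (hγ t ht)
  rw [← heq, map_sub, ← hftc]
  exact intervalIntegral.integral_mono_on zero_le_one hl_int hF_int fun t _ ↦ hle _

theorem randers_segment_minimizes_length
    {E : Type*} [NormedAddCommGroup E] [InnerProductSpace ℝ E]
    (W : E) (hW : ‖W‖ < 1)
    (F : E → ℝ)
    (hF : ∀ V : E, F V =
      (Real.sqrt (⟪W, V⟫ ^ 2 + (1 - ⟪W, W⟫) * ⟪V, V⟫) - ⟪W, V⟫) / (1 - ⟪W, W⟫))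
    (p q : E) :
    (∀ (γ γ' : ℝ → E),
        (∀ t ∈ Set.Icc (0 : ℝ) 1, HasDerivAt γ (γ' t) t) →
        ContinuousOn γ' (Set.Icc (0 : ℝ) 1) →
        γ 0 = p → γ 1 = q →
        (∫ t in (0 : ℝ)..1, F (γ' t)) ≥ F (q - p)) ∧
    (∫ t in (0 : ℝ)..1, F (deriv (fun s : ℝ => p + s • (q - p)) t)) = F (q - p) ∧
    sInf {L : ℝ | ∃ (γ γ' : ℝ → E),
        (∀ t ∈ Set.Icc (0 : ℝ) 1, HasDerivAt γ (γ' t) t) ∧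
        ContinuousOn γ' (Set.Icc (0 : ℝ) 1) ∧
        γ 0 = p ∧ γ 1 = q ∧ L = ∫ t in (0 : ℝ)..1, F (γ' t)} = F (q - p) := by
  have hc : 0 < 1 - ⟪W, W⟫ := by
    rw [real_inner_self_eq_norm_sq]
    nlinarith [norm_nonneg W]
  have hcont : Continuous F := by
    rw [funext hF]
    fun_prop
  obtain ⟨l, hle, hl⟩ := exists_randers_support W (q - p) hc
  simp only [← hF] at hle hl
  have hlower (γ γ' : ℝ → E) (hγ : ∀ t ∈ Set.Icc (0 : ℝ) 1, HasDerivAt γ (γ' t) t)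
      (hγ' : ContinuousOn γ' (Set.Icc (0 : ℝ) 1)) (h0 : γ 0 = p) (h1 : γ 1 = q) :
      F (q - p) ≤ ∫ t in (0 : ℝ)..1, F (γ' t) := by
    subst h0 h1
    exact le_integral_of_support hcont l hle hγ hγ' hl
  have hsegment (t : ℝ) : HasDerivAt (fun s : ℝ => p + s • (q - p)) (q - p) t := by
    simpa using ((hasDerivAt_id t).smul_const (q - p)).const_add p
  refine ⟨hlower, ?_, IsLeast.csInf_eq ⟨?_, ?_⟩⟩
  · simp [(hsegment _).deriv]
  · exact ⟨_, fun _ ↦ q - p, fun t _ ↦ hsegment t, continuousOn_const, by simp, by simp, by simp⟩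
  · rintro _ ⟨γ, γ', hγ, hγ', h0, h1, rfl⟩
    exact hlower γ γ' hγ hγ' h0 h1
end

section
/- Let E be a finite-dimensional real inner product space, W ∈ E with ‖W‖ < 1, λ := 1 − ⟪W,W⟫, F(V) = (√(⟪W,V⟫² + λ⟪V,V⟫) − ⟪W,V⟫)/λ the Randers metric, A ⊆ E a nonempty compact set, and ρ(q) := inf_{p∈A} F(q − p). Then for every τ > 0, the wavefront at time τ satisfies {q ∈ E : ρ(q) = τ} = {p + τ•V : p ∈ A, V ∈ E, ‖V − W‖ = 1, and F(p + τ•V − p′) ≥ τ for all p′ ∈ A}. -/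
open scoped RealInnerProductSpace

/-- The sphere of radius `τ` of the Randers metric with wind `W` is the Euclidean sphere of
radius `τ` centred at `τ • W`. -/
theorem randers_eq_iff_norm_sub_smul_eq {E : Type*} [NormedAddCommGroup E]
    [InnerProductSpace ℝ E] {W : E} (hW : ‖W‖ < 1) (U : E) {τ : ℝ} (hτ : 0 < τ) :
    (Real.sqrt (⟪W, U⟫ ^ 2 + (1 - ⟪W, W⟫) * ⟪U, U⟫) - ⟪W, U⟫) / (1 - ⟪W, W⟫) = τ ↔
      ‖U - τ • W‖ = τ := by
  have hl : 0 < 1 - ⟪W, W⟫ := by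
    rw [real_inner_self_eq_norm_sq]
    nlinarith [norm_nonneg W]
  have hu : 0 ≤ ⟪U, U⟫ := real_inner_self_nonneg
  have hnorm : ‖U - τ • W‖ ^ 2 = ⟪U, U⟫ - 2 * τ * ⟪W, U⟫ + τ ^ 2 * ⟪W, W⟫ := by
    rw [norm_sub_sq_real, real_inner_smul_right, norm_smul, mul_pow, Real.norm_eq_abs, sq_abs,
      real_inner_comm, real_inner_self_eq_norm_sq, real_inner_self_eq_norm_sq]
    ring
  rw [← sq_eq_sq₀ (norm_nonneg _) hτ.le, hnorm, div_eq_iff hl.ne']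
  generalize ⟪W, U⟫ = w, ⟪U, U⟫ = u, ⟪W, W⟫ = c at *
  constructor
  · intro h
    have hs : Real.sqrt (w ^ 2 + (1 - c) * u) ^ 2 = w ^ 2 + (1 - c) * u :=
      Real.sq_sqrt (by positivity)
    rw [show Real.sqrt (w ^ 2 + (1 - c) * u) = τ * (1 - c) + w by linarith] at hs
    apply mul_left_cancel₀ hl.ne'
    linear_combination -hs
  · intro h
    have hw : 0 ≤ τ * (1 - c) + w := by
      have h2 : 0 ≤ τ * (τ * (1 - c) + 2 * w) := by linarith
      have := nonneg_of_mul_nonneg_right h2 hτ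
      nlinarith [mul_pos hτ hl]
    rw [show w ^ 2 + (1 - c) * u = (τ * (1 - c) + w) ^ 2 by linear_combination (1 - c) * h,
      Real.sqrt_sq hw]
    ring

theorem wavefront_at_time_tau
    {E : Type*} [NormedAddCommGroup E] [InnerProductSpace ℝ E]
    [FiniteDimensional ℝ E]
    (W : E) (hW : ‖W‖ < 1)
    (F : E → ℝ)
    (hF : ∀ V : E, F V =
      (Real.sqrt (⟪W, V⟫ ^ 2 + (1 - ⟪W, W⟫) * ⟪V, V⟫) - ⟪W, V⟫) / (1 - ⟪W, W⟫))
    (A : Set E) (hA : A.Nonempty) (hAc : IsCompact A)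
    (ρ : E → ℝ)
    (hρ : ∀ q : E, ρ q = sInf ((fun p => F (q - p)) '' A)) :
    ∀ τ : ℝ, 0 < τ →
      {q : E | ρ q = τ} =
        {x : E | ∃ p ∈ A, ∃ V : E, ‖V - W‖ = 1 ∧ x = p + τ • V ∧
          ∀ p' ∈ A, F (p + τ • V - p') ≥ τ} := by
  intro τ hτ
  have hF_smul (V : E) : F (τ • V) = τ ↔ ‖V - W‖ = 1 := by
    rw [hF, randers_eq_iff_norm_sub_smul_eq hW _ hτ, ← smul_sub, norm_smul, Real.norm_of_nonneg
      hτ.le, mul_eq_left₀ hτ.ne']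
  have hcont : Continuous F := by
    rw [funext hF]
    fun_prop
  ext q
  simp only [Set.mem_ofPred_eq]
  constructor
  · intro hq
    have hK : IsCompact ((fun p => F (q - p)) '' A) := hAc.image (by fun_prop)
    have hle : ∀ p' ∈ A, τ ≤ F (q - p') := fun p' hp' => by
      rw [← hq, hρ]
      exact csInf_le hK.bddBelow (Set.mem_image_of_mem _ hp')
    obtain ⟨p, hp, hpq⟩ := hK.sInf_mem (hA.image _)
    have hsmul : τ • τ⁻¹ • (q - p) = q - p := smul_inv_smul₀ hτ.ne' _
    refine ⟨p, hp, τ⁻¹ • (q - p), ?_, ?_, ?_⟩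
    · rw [← hF_smul, hsmul, ← hq, hρ]
      exact hpq
    · rw [hsmul, add_sub_cancel]
    · rwa [hsmul, add_sub_cancel]
  · rintro ⟨p, hp, V, hV, rfl, hle⟩
    rw [hρ]
    refine IsLeast.csInf_eq ⟨⟨p, hp, ?_⟩, ?_⟩
    · simpa only [add_sub_cancel_left] using (hF_smul V).2 hV
    · rintro _ ⟨p', hp', rfl⟩
      exact hle p' hp'
end

section
/- Let E be a finite-dimensional real inner product space, W ∈ E with ‖W‖ < 1, λ := 1 − ⟪W,W⟫, F(V) = (√(⟪W,V⟫² + λ⟪V,V⟫) − ⟪W,V⟫)/λ the Randers metric, A ⊆ E a nonempty compact set, and ρ(q) := inf_{p∈A} F(q − p). Then for all 0 ≤ τ₁ and every q ∈ E with ρ(q) ≥ τ₁, one has ρ(q) = τ₁ + inf { F(q − r) : r ∈ E, ρ(r) = τ₁ }; in particular there exists r with ρ(r) = τ₁ and ρ(q) = τ₁ + F(q − r). -/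
open scoped RealInnerProductSpace

/-- The Randers metric with Zermelo data the inner product and the wind `W`. -/
noncomputable def randersMetric {E : Type*} [NormedAddCommGroup E] [InnerProductSpace ℝ E]
    (W V : E) : ℝ :=
  (Real.sqrt (⟪W, V⟫ ^ 2 + (1 - ⟪W, W⟫) * ⟪V, V⟫) - ⟪W, V⟫) / (1 - ⟪W, W⟫)

namespace randersMetric

variable {E : Type*} [NormedAddCommGroup E] [InnerProductSpace ℝ E] {W : E}

lemma one_sub_inner_self_pos (hW : ‖W‖ < 1) : 0 < 1 - ⟪W, W⟫ := by
  rw [real_inner_self_eq_norm_sq]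
  nlinarith [norm_nonneg W]

lemma nonneg (hW : ‖W‖ < 1) (V : E) : 0 ≤ randersMetric W V := by
  have hpos := one_sub_inner_self_pos hW
  refine div_nonneg (sub_nonneg.2 (Real.le_sqrt_of_sq_le ?_)) hpos.le
  have := mul_nonneg hpos.le (real_inner_self_nonneg (x := V))
  linarith

lemma continuous (W : E) : Continuous (randersMetric W) := by
  unfold randersMetric
  fun_prop

lemma norm_sub_smul_sq (W V : E) (s : ℝ) :
    ‖V - s • W‖ ^ 2 = ⟪V, V⟫ - 2 * s * ⟪W, V⟫ + s ^ 2 * ⟪W, W⟫ := by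
  rw [← real_inner_self_eq_norm_sq]
  simp only [inner_sub_left, inner_sub_right, real_inner_smul_left, real_inner_smul_right,
    real_inner_comm V W]
  ring

/-- `V` lies on the unit indicatrix translated by the wind and scaled by its Randers length. -/
lemma norm_sub_smul (hW : ‖W‖ < 1) (V : E) :
    ‖V - randersMetric W V • W‖ = randersMetric W V := by
  have hpos := one_sub_inner_self_pos hW
  have hc := mul_nonneg hpos.le (real_inner_self_nonneg (x := V))
  have hs := Real.sq_sqrt (add_nonneg (sq_nonneg ⟪W, V⟫) hc)
  have hx : (1 - ⟪W, W⟫) * randersMetric W V + ⟪W, V⟫ =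
      Real.sqrt (⟪W, V⟫ ^ 2 + (1 - ⟪W, W⟫) * ⟪V, V⟫) := by
    unfold randersMetric
    rw [mul_div_cancel₀ _ hpos.ne']
    ring
  rw [← hx] at hs
  rw [← sq_eq_sq₀ (norm_nonneg _) (nonneg hW V), norm_sub_smul_sq]
  refine mul_left_cancel₀ hpos.ne' ?_
  linarith

lemma le_of_norm_sub_smul_le (hW : ‖W‖ < 1) {V : E} {s : ℝ} (h : ‖V - s • W‖ ≤ s) :
    randersMetric W V ≤ s := by
  have hpos := one_sub_inner_self_pos hW
  have hs : 0 ≤ s := (norm_nonneg _).trans h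
  have hc := real_inner_self_nonneg (x := V)
  have hsq := pow_le_pow_left₀ (norm_nonneg _) h 2
  rw [norm_sub_smul_sq] at hsq
  rcases hs.eq_or_lt with rfl | hs
  · have : V = 0 := by simpa using h
    simp [randersMetric, this]
  · have hb : 0 ≤ (1 - ⟪W, W⟫) * s + 2 * ⟪W, V⟫ := by
      refine nonneg_of_mul_nonneg_right ?_ hs
      linarith
    have hls := mul_pos hpos hs
    rw [randersMetric, div_le_iff₀ hpos, sub_le_iff_le_add, Real.sqrt_le_left (by linarith)]
    have := mul_le_mul_of_nonneg_left hsq hpos.le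
    linarith

lemma add_le (hW : ‖W‖ < 1) (U V : E) :
    randersMetric W (U + V) ≤ randersMetric W U + randersMetric W V := by
  apply le_of_norm_sub_smul_le hW
  rw [add_smul, add_sub_add_comm]
  exact (norm_add_le _ _).trans_eq (by rw [norm_sub_smul hW, norm_sub_smul hW])

lemma smul_le (hW : ‖W‖ < 1) {s : ℝ} (hs : 0 ≤ s) (V : E) :
    randersMetric W (s • V) ≤ s * randersMetric W V := by
  apply le_of_norm_sub_smul_le hW
  rw [mul_smul, ← smul_sub, norm_smul, norm_sub_smul hW, Real.norm_of_nonneg hs]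

end randersMetric

theorem huygens_principle_constant_wind
    {E : Type*} [NormedAddCommGroup E] [InnerProductSpace ℝ E]
    [FiniteDimensional ℝ E]
    (W : E) (hW : ‖W‖ < 1)
    (F : E → ℝ)
    (hF : ∀ V : E, F V =
      (Real.sqrt (⟪W, V⟫ ^ 2 + (1 - ⟪W, W⟫) * ⟪V, V⟫) - ⟪W, V⟫) / (1 - ⟪W, W⟫))
    (A : Set E) (hA : A.Nonempty) (hAc : IsCompact A)
    (ρ : E → ℝ)
    (hρ : ∀ q : E, ρ q = sInf ((fun p => F (q - p)) '' A)) :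
    ∀ τ₁ : ℝ, 0 ≤ τ₁ → ∀ q : E, τ₁ ≤ ρ q →
      (ρ q = τ₁ + sInf ((fun r => F (q - r)) '' {r : E | ρ r = τ₁}) ∧
        ∃ r : E, ρ r = τ₁ ∧ ρ q = τ₁ + F (q - r)) := by
  intro τ hτ q hq
  obtain rfl : F = randersMetric W := funext hF
  have hle (q p : E) (hp : p ∈ A) : ρ q ≤ randersMetric W (q - p) := by
    rw [hρ]
    refine csInf_le ⟨0, ?_⟩ (Set.mem_image_of_mem _ hp)
    rintro _ ⟨p, -, rfl⟩
    exact randersMetric.nonneg hW _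
  have hex (q : E) : ∃ p ∈ A, ρ q = randersMetric W (q - p) := by
    rw [hρ]
    exact hAc.exists_sInf_image_eq hA
      ((randersMetric.continuous W).comp (by fun_prop)).continuousOn
  have htri (q r : E) : ρ q ≤ ρ r + randersMetric W (q - r) := by
    obtain ⟨p, hp, hpr⟩ := hex r
    have := randersMetric.add_le hW (r - p) (q - r)
    rw [sub_add_sub_comm, add_comm r q, add_sub_add_right_eq_sub] at this
    linarith [hle q p hp]
  have hmain : ∃ r : E, ρ r = τ ∧ ρ q = τ + randersMetric W (q - r) := by
    obtain ⟨p, hp, hpq⟩ := hex q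
    have hT : 0 ≤ ρ q := hτ.trans hq
    set s := τ / ρ q
    have hs : s * ρ q = τ :=
      div_mul_cancel_of_imp fun h => le_antisymm (h ▸ hq) hτ
    have hs0 : 0 ≤ s := div_nonneg hτ hT
    have hs1 : s ≤ 1 := div_le_one_of_le₀ hq hT
    have h₁ := randersMetric.smul_le hW hs0 (q - p)
    have h₂ := randersMetric.smul_le hW (sub_nonneg.2 hs1) (q - p)
    rw [← hpq] at h₁ h₂
    have h₃ := hle (p + s • (q - p)) p hp
    have h₄ := htri q (p + s • (q - p))
    rw [add_sub_cancel_left] at h₃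
    rw [show q - (p + s • (q - p)) = (1 - s) • (q - p) by module] at h₄
    refine ⟨p + s • (q - p), ?_, ?_⟩
    · linarith
    · rw [show q - (p + s • (q - p)) = (1 - s) • (q - p) by module]
      linarith
  refine ⟨?_, hmain⟩
  obtain ⟨r, hr, hqr⟩ := hmain
  have hleast : IsLeast ((fun r => randersMetric W (q - r)) '' {r : E | ρ r = τ})
      (randersMetric W (q - r)) := by
    refine ⟨⟨r, hr, rfl⟩, ?_⟩
    rintro _ ⟨x, hx, rfl⟩
    have := htri q x
    rw [show ρ x = τ from hx] at this
    dsimp only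
    linarith
  rw [hleast.csInf_eq, hqr]
end

section
/- Let E be a real inner product space with inner product ⟪·,·⟫, W ∈ E with ‖W‖ < 1, λ := 1 − ⟪W,W⟫, and F(V) = (√(⟪W,V⟫² + λ⟪V,V⟫) − ⟪W,V⟫)/λ the Randers metric. Then for every V ≠ 0 and every U ∈ E, the derivative of F at V in the direction U vanishes (i.e. (fderiv ℝ F V) U = 0) if and only if ⟪U, (F(V))⁻¹•V − W⟫ = 0. -/
open scoped RealInnerProductSpace

section Randers

variable {E : Type*} [NormedAddCommGroup E] [InnerProductSpace ℝ E]

theorem one_sub_inner_self_pos {W : E} (hW : ‖W‖ < 1) : 0 < 1 - ⟪W, W⟫ := by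
  rw [real_inner_self_eq_norm_sq]
  nlinarith [norm_nonneg W]

theorem hasFDerivAt_randers (W : E) (c : ℝ) {V : E} (h : ⟪W, V⟫ ^ 2 + c * ⟪V, V⟫ ≠ 0) :
    HasFDerivAt (fun x : E ↦ (√(⟪W, x⟫ ^ 2 + c * ⟪x, x⟫) - ⟪W, x⟫) / c)
      (c⁻¹ • ((√(⟪W, V⟫ ^ 2 + c * ⟪V, V⟫))⁻¹ • (⟪W, V⟫ • innerSL ℝ W + c • innerSL ℝ V)
        - innerSL ℝ W)) V := by
  have hlin : HasFDerivAt (fun x : E ↦ ⟪W, x⟫) (innerSL ℝ W) V := (innerSL ℝ W).hasFDerivAt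
  have hself : HasFDerivAt (fun x : E ↦ ⟪x, x⟫) (2 • innerSL ℝ V) V := by
    simpa only [real_inner_self_eq_norm_sq] using (hasStrictFDerivAt_norm_sq V).hasFDerivAt
  have hF := ((((hlin.pow 2).add (hself.const_mul c)).sqrt h).sub hlin).const_mul c⁻¹
  refine (hF.congr_fderiv ?_).congr_of_eventuallyEq (.of_forall fun x ↦ ?_)
  · ext U
    simp
    left
    ring
  · simp [div_eq_inv_mul]

end Randers

theorem randers_orthogonality_characterization
    {E : Type*} [NormedAddCommGroup E] [InnerProductSpace ℝ E]
    (W : E) (hW : ‖W‖ < 1)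
    (F : E → ℝ)
    (hF : ∀ V : E, F V =
      (Real.sqrt (⟪W, V⟫ ^ 2 + (1 - ⟪W, W⟫) * ⟪V, V⟫) - ⟪W, V⟫) / (1 - ⟪W, W⟫)) :
    ∀ V : E, V ≠ 0 → ∀ U : E,
      (fderiv ℝ F V) U = 0 ↔ ⟪U, (F V)⁻¹ • V - W⟫ = 0 := by
  intro V hV U
  have hc := one_sub_inner_self_pos hW
  obtain rfl := funext hF
  generalize 1 - ⟪W, W⟫ = c at *
  have hVV : 0 < c * ⟪V, V⟫ := mul_pos hc (real_inner_self_pos.2 hV)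
  have hpos : 0 < ⟪W, V⟫ ^ 2 + c * ⟪V, V⟫ := by positivity
  rw [(hasFDerivAt_randers W c hpos.ne').fderiv]
  have hlt : ⟪W, V⟫ < √(⟪W, V⟫ ^ 2 + c * ⟪V, V⟫) := Real.lt_sqrt_of_sq_lt (by linarith)
  have hD := Real.sqrt_pos.2 hpos
  beta_reduce
  generalize √(⟪W, V⟫ ^ 2 + c * ⟪V, V⟫) = D at *
  have hsub : D - ⟪W, V⟫ ≠ 0 := (sub_pos.2 hlt).ne'
  simp only [inner_sub_right, inner_smul_right, smul_apply,
    sub_apply, add_apply, innerSL_apply_apply,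
    smul_eq_mul, real_inner_comm U, inv_div]
  have key : c⁻¹ * (D⁻¹ * (⟪W, V⟫ * ⟪U, W⟫ + c * ⟪U, V⟫) - ⟪U, W⟫) =
      (D - ⟪W, V⟫) / (c * D) * (c / (D - ⟪W, V⟫) * ⟪U, V⟫ - ⟪U, W⟫) := by
    field_simp
    ring
  rw [key, mul_eq_zero_iff_left (div_ne_zero hsub (mul_pos hc hD).ne')]
end

section
/- Let E be a real inner product space with inner product ⟪·,·⟫ and norm ‖·‖, let W ∈ E with ‖W‖ < 1, set λ := 1 − ⟪W,W⟫, and define F : E → ℝ by F(V) = (√(⟪W,V⟫² + λ⟪V,V⟫) − ⟪W,V⟫)/λ. Then for every V ∈ E, F(V) = 1 if and only if ‖V − W‖ = 1 (equivalently ⟪V − W, V − W⟫ = 1). -/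
open scoped RealInnerProductSpace

theorem randers_indicatrix_relation
    {E : Type*} [NormedAddCommGroup E] [InnerProductSpace ℝ E]
    (W : E) (hW : ‖W‖ < 1)
    (F : E → ℝ)
    (hF : ∀ V : E, F V =
      (Real.sqrt (⟪W, V⟫ ^ 2 + (1 - ⟪W, W⟫) * ⟪V, V⟫) - ⟪W, V⟫) / (1 - ⟪W, W⟫)) :
    ∀ V : E, F V = 1 ↔ ‖V - W‖ = 1 := by
  intro V
  have hpos : 0 < 1 - ⟪W, W⟫ := by
    rw [real_inner_self_eq_norm_sq]
    nlinarith [norm_nonneg W]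
  have hV : 0 ≤ ⟪V, V⟫ := real_inner_self_nonneg
  have hsphere : ‖V - W‖ = 1 ↔ ⟪V, V⟫ = (1 - ⟪W, W⟫) + 2 * ⟪W, V⟫ := by
    rw [← sq_eq_sq₀ (norm_nonneg _) zero_le_one, norm_sub_sq_real, real_inner_comm,
      real_inner_self_eq_norm_sq, real_inner_self_eq_norm_sq]
    constructor <;> intro h <;> linarith
  rw [hF, hsphere, div_eq_one_iff_eq hpos.ne', sub_eq_iff_eq_add]
  generalize 1 - ⟪W, W⟫ = l at *
  generalize ⟪W, V⟫ = a at *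
  generalize ⟪V, V⟫ = b at *
  constructor
  · intro h
    have hsq := Real.sq_sqrt (add_nonneg (sq_nonneg a) (mul_nonneg hpos.le hV))
    rw [h] at hsq
    exact mul_left_cancel₀ hpos.ne' (by linarith)
  · intro h
    rw [show a ^ 2 + l * b = (l + a) ^ 2 by rw [h]; ring]
    exact Real.sqrt_sq (by linarith)
end

section
/- Let E be a real inner product space, W ∈ E with ‖W‖ < 1, λ := 1 − ⟪W,W⟫, and F(V) = (√(⟪W,V⟫² + λ⟪V,V⟫) − ⟪W,V⟫)/λ. Then F is subadditive: for all U, V ∈ E, F(U + V) ≤ F(U) + F(V). In particular the function d(p,q) := F(q − p) satisfies the triangle inequality d(p,q) ≤ d(p,r) + d(r,q). -/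
open scoped RealInnerProductSpace

/-- For `0 ≤ c`, the square root of the quadratic form `⟪W, V⟫ ^ 2 + c * ⟪V, V⟫` is subadditive. -/
theorem sqrt_inner_sq_add_mul_inner_self_subadditive
    {E : Type*} [NormedAddCommGroup E] [InnerProductSpace ℝ E]
    (W : E) {c : ℝ} (hc : 0 ≤ c) (U V : E) :
    Real.sqrt (⟪W, U + V⟫ ^ 2 + c * ⟪U + V, U + V⟫) ≤
      Real.sqrt (⟪W, U⟫ ^ 2 + c * ⟪U, U⟫) + Real.sqrt (⟪W, V⟫ ^ 2 + c * ⟪V, V⟫) := by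
  have hU : 0 ≤ ⟪W, U⟫ ^ 2 + c * ⟪U, U⟫ :=
    add_nonneg (sq_nonneg _) (mul_nonneg hc real_inner_self_nonneg)
  have hV : 0 ≤ ⟪W, V⟫ ^ 2 + c * ⟪V, V⟫ :=
    add_nonneg (sq_nonneg _) (mul_nonneg hc real_inner_self_nonneg)
  have cauchy : ⟪U, V⟫ * ⟪U, V⟫ ≤ ⟪U, U⟫ * ⟪V, V⟫ := real_inner_mul_inner_self_le U V
  have cross : 0 ≤ ⟪W, U⟫ ^ 2 * ⟪V, V⟫ + ⟪W, V⟫ ^ 2 * ⟪U, U⟫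
      - 2 * (⟪W, U⟫ * ⟪W, V⟫ * ⟪U, V⟫) := by
    have h : 0 ≤ ⟪⟪W, U⟫ • V - ⟪W, V⟫ • U, ⟪W, U⟫ • V - ⟪W, V⟫ • U⟫ :=
      real_inner_self_nonneg
    simp only [inner_sub_left, inner_sub_right, real_inner_smul_left, real_inner_smul_right,
      real_inner_comm U V] at h
    linarith
  have polar : ⟪W, U⟫ * ⟪W, V⟫ + c * ⟪U, V⟫ ≤
      Real.sqrt (⟪W, U⟫ ^ 2 + c * ⟪U, U⟫) * Real.sqrt (⟪W, V⟫ ^ 2 + c * ⟪V, V⟫) := by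
    rw [← Real.sqrt_mul hU]
    apply Real.le_sqrt_of_sq_le
    linarith [mul_nonneg hc cross, mul_nonneg (mul_nonneg hc hc) (sub_nonneg.2 cauchy)]
  refine Real.sqrt_le_iff.2 ⟨by positivity, ?_⟩
  rw [add_sq, Real.sq_sqrt hU, Real.sq_sqrt hV, inner_add_right, real_inner_add_add_self]
  linarith

theorem randers_subadditive
    {E : Type*} [NormedAddCommGroup E] [InnerProductSpace ℝ E]
    (W : E) (hW : ‖W‖ < 1)
    (F : E → ℝ)
    (hF : ∀ V : E, F V =
      (Real.sqrt (⟪W, V⟫ ^ 2 + (1 - ⟪W, W⟫) * ⟪V, V⟫) - ⟪W, V⟫) / (1 - ⟪W, W⟫)) :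
    (∀ U V : E, F (U + V) ≤ F U + F V) ∧
      (∀ p q r : E, F (q - p) ≤ F (r - p) + F (q - r)) := by
  have pos : 0 < 1 - ⟪W, W⟫ := by
    rw [real_inner_self_eq_norm_sq]
    nlinarith [norm_nonneg W]
  have subadd : ∀ U V : E, F (U + V) ≤ F U + F V := fun U V => by
    rw [hF, hF, hF, ← add_div]
    gcongr
    linarith [sqrt_inner_sq_add_mul_inner_self_subadditive W pos.le U V,
      inner_add_right (𝕜 := ℝ) W U V]
  refine ⟨subadd, fun p q r => ?_⟩
  simpa using subadd (r - p) (q - r)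
end

section
/- Let E be a real inner product space with norm ‖·‖, W ∈ E with ‖W‖ < 1, λ := 1 − ⟪W,W⟫, and F(V) = (√(⟪W,V⟫² + λ⟪V,V⟫) − ⟪W,V⟫)/λ. Then the unit sublevel set of F is the closed unit ball of the inner-product norm centered at W: {V ∈ E : F(V) ≤ 1} = {V ∈ E : ‖V − W‖ ≤ 1}. Equivalently, for every V, F(V) ≤ 1 if and only if ‖V − W‖ ≤ 1. -/
open scoped RealInnerProductSpace

theorem randers_unit_sublevel_is_translated_ball
    {E : Type*} [NormedAddCommGroup E] [InnerProductSpace ℝ E]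
    (W : E) (hW : ‖W‖ < 1)
    (F : E → ℝ)
    (hF : ∀ V : E, F V =
      (Real.sqrt (⟪W, V⟫ ^ 2 + (1 - ⟪W, W⟫) * ⟪V, V⟫) - ⟪W, V⟫) / (1 - ⟪W, W⟫)) :
    {V : E | F V ≤ 1} = {V : E | ‖V - W‖ ≤ 1} ∧
      ∀ V : E, F V ≤ 1 ↔ ‖V - W‖ ≤ 1 := by
  have key : ∀ V : E, F V ≤ 1 ↔ ‖V - W‖ ≤ 1 := by
    intro V
    have hpos : 0 < 1 - ⟪W, W⟫ := by
      rw [real_inner_self_eq_norm_sq]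
      nlinarith [norm_nonneg W]
    have hV : 0 ≤ ⟪V, V⟫ := real_inner_self_nonneg
    have hball : ‖V - W‖ ≤ 1 ↔ ⟪V, V⟫ ≤ 1 - ⟪W, W⟫ + 2 * ⟪W, V⟫ := by
      rw [← sq_le_one_iff₀ (norm_nonneg _), norm_sub_sq_real, real_inner_comm,
        ← real_inner_self_eq_norm_sq, ← real_inner_self_eq_norm_sq]
      constructor <;> intro h <;> linarith
    rw [hF, div_le_one hpos, sub_le_iff_le_add, Real.sqrt_le_iff, hball]
    constructor
    · rintro ⟨-, h⟩
      refine le_of_mul_le_mul_left ?_ hpos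
      linarith
    · intro h
      have hmul := mul_le_mul_of_nonneg_left h hpos.le
      constructor <;> linarith
  exact ⟨Set.ext key, key⟩
end

section
/- Let x₀, y₀, z₀, a, b, ω be real numbers with ω ≠ 0, and define x, y, z : ℝ → ℝ by x(t) = x₀ + (a/ω)·sin(ωt) + (b/ω)·(cos(ωt) − 1), y(t) = y₀ + ωt, z(t) = z₀ + (a/ω)·(1 − cos(ωt)) + (b/ω)·sin(ωt). Then for every t ∈ ℝ the geodesic system x″(t) + y′(t)·z′(t) = 0, y″(t) = 0, z″(t) − x′(t)·y′(t) = 0 holds, and the initial conditions are x(0) = x₀, y(0) = y₀, z(0) = z₀, x′(0) = a, y′(0) = ω, z′(0) = b. -/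
theorem hasDerivAt_sin_const_mul (ω t : ℝ) :
    HasDerivAt (fun s : ℝ => Real.sin (ω * s)) (Real.cos (ω * t) * ω) t := by
  simpa using ((hasDerivAt_id t).const_mul ω).sin

theorem hasDerivAt_cos_const_mul (ω t : ℝ) :
    HasDerivAt (fun s : ℝ => Real.cos (ω * s)) (-Real.sin (ω * t) * ω) t := by
  simpa using ((hasDerivAt_id t).const_mul ω).cos

theorem killing_wind_geodesic_system
    (x₀ y₀ z₀ a b ω : ℝ) (hω : ω ≠ 0)
    (x y z : ℝ → ℝ)
    (hx : ∀ t : ℝ, x t = x₀ + (a / ω) * Real.sin (ω * t) + (b / ω) * (Real.cos (ω * t) - 1))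
    (hy : ∀ t : ℝ, y t = y₀ + ω * t)
    (hz : ∀ t : ℝ, z t = z₀ + (a / ω) * (1 - Real.cos (ω * t)) + (b / ω) * Real.sin (ω * t)) :
    (∀ t : ℝ,
      deriv (deriv x) t + deriv y t * deriv z t = 0 ∧
      deriv (deriv y) t = 0 ∧
      deriv (deriv z) t - deriv x t * deriv y t = 0) ∧
    x 0 = x₀ ∧ y 0 = y₀ ∧ z 0 = z₀ ∧
    deriv x 0 = a ∧ deriv y 0 = ω ∧ deriv z 0 = b := by
  have hS := hasDerivAt_sin_const_mul ω
  have hC := hasDerivAt_cos_const_mul ω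
  have dx : deriv x = fun t => a * Real.cos (ω * t) - b * Real.sin (ω * t) := by
    funext t
    rw [funext hx]
    refine HasDerivAt.deriv ?_
    refine ((((hS t).const_mul (a / ω)).const_add x₀).add
      (((hC t).sub_const 1).const_mul (b / ω))).congr_deriv ?_
    field_simp
    ring
  have dy : deriv y = fun _ => ω := by
    funext t
    rw [funext hy]
    refine HasDerivAt.deriv ?_
    simpa using ((hasDerivAt_id t).const_mul ω).const_add y₀
  have dz : deriv z = fun t => a * Real.sin (ω * t) + b * Real.cos (ω * t) := by
    funext t
    rw [funext hz]
    refine HasDerivAt.deriv ?_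
    refine (((((hC t).const_sub 1).const_mul (a / ω)).const_add z₀).add
      ((hS t).const_mul (b / ω))).congr_deriv ?_
    field_simp
  have ddx (t : ℝ) : deriv (deriv x) t =
      a * (-Real.sin (ω * t) * ω) - b * (Real.cos (ω * t) * ω) := by
    rw [dx]
    exact (((hC t).const_mul a).sub ((hS t).const_mul b)).deriv
  have ddz (t : ℝ) : deriv (deriv z) t =
      a * (Real.cos (ω * t) * ω) + b * (-Real.sin (ω * t) * ω) := by
    rw [dz]
    exact (((hS t).const_mul a).add ((hC t).const_mul b)).deriv
  refine ⟨fun t => ⟨?_, ?_, ?_⟩, ?_, ?_, ?_, ?_, ?_, ?_⟩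
  · rw [ddx, dy, dz]
    ring
  · simp [dy]
  · rw [ddz, dx, dy]
    ring
  · simp [hx]
  · simp [hy]
  · simp [hz]
  · simp [dx]
  · simp [dy]
  · simp [dz]
end
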